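/- Let x ∈ [v_1, v_n] be a point and i an index with v_i < x. For w ∈ [w_i^−, w_i^+], let σ_x(w) denote the weight of the left cluster for x containing v_i under the scenario s(i, w). Then the function w ↦ σ_x(w) − w is nondecreasing on [w_i^−, w_i^+] (clusters can only be merged into the cluster of v_i as w increases). -/

import Mathlib

open Finset
open scoped Classical

namespace DPN

noncomputable def score (τ c : ℝ) (v w : ℕ → ℝ) (h r j : ℕ) : ℝ :=
  τ * (v h - v j) + (∑ l ∈ Finset.Ioc r j, w l) / c

noncomputable def nextHead (τ c : ℝ) (v w : ℕ → ℝ) (h r : ℕ) : ℕ :=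
  (((Finset.Ioc r h).filter (fun j =>
      ∀ j' ∈ Finset.Ioc r h, score τ c v w h r j' ≤ score τ c v w h r j)).max).getD h

noncomputable def heads (τ c : ℝ) (v w : ℕ → ℝ) (h : ℕ) : ℕ → ℕ
  | 0 => 0
  | m + 1 => nextHead τ c v w h (heads τ c v w h m)

noncomputable def hIdx (n : ℕ) (v : ℕ → ℝ) (x : ℝ) : ℕ :=
  ((Finset.Icc 1 n).filter (fun i => v i < x)).card

noncomputable def phiL (n : ℕ) (τ c : ℝ) (v w : ℕ → ℝ) (x : ℝ) : ℝ :=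
  ∑ m ∈ Finset.range n,
    ((∑ l ∈ Finset.Ioc (heads τ c v w (hIdx n v x) m) (heads τ c v w (hIdx n v x) (m + 1)), w l) *
        (τ * (x - v (heads τ c v w (hIdx n v x) (m + 1)))) +
      (∑ l ∈ Finset.Ioc (heads τ c v w (hIdx n v x) m) (heads τ c v w (hIdx n v x) (m + 1)), w l) ^ 2 /
        (2 * c))

def rv (n : ℕ) (v : ℕ → ℝ) : ℕ → ℝ := fun l => -v (n + 1 - l)

def rw (n : ℕ) (w : ℕ → ℝ) : ℕ → ℝ := fun l => w (n + 1 - l)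

noncomputable def phiR (n : ℕ) (τ c : ℝ) (v w : ℕ → ℝ) (x : ℝ) : ℝ :=
  phiL n τ c (rv n v) (rw n w) (-x)

noncomputable def phi (n : ℕ) (τ c : ℝ) (v w : ℕ → ℝ) (x : ℝ) : ℝ :=
  phiL n τ c v w x + phiR n τ c v w x

/-- The set of scenarios: each vertex weight lies in its interval. -/
def scenarios (n : ℕ) (wm wp : ℕ → ℝ) : Set (ℕ → ℝ) :=
  {s | ∀ i, 1 ≤ i → i ≤ n → wm i ≤ s i ∧ s i ≤ wp i}

/-- The gap `Γ^s(x, y) = Φ^s(x) − Φ^s(y)`. -/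
noncomputable def gap (n : ℕ) (τ c : ℝ) (v s : ℕ → ℝ) (x y : ℝ) : ℝ :=
  phi n τ c v s x - phi n τ c v s y

/-- The regret `R^s(x) = Φ^s(x) − Φ^s(m^s)` (`Φ^s(m^s)` = min of `Φ^s` on `[v_1, v_n]`). -/
noncomputable def regret (n : ℕ) (τ c : ℝ) (v s : ℕ → ℝ) (x : ℝ) : ℝ :=
  phi n τ c v s x - sInf ((fun z => phi n τ c v s z) '' Set.Icc (v 1) (v n))

/-- The maximum regret `R_max(x) = sup_{s ∈ S} R^s(x)`. -/
noncomputable def maxRegret (n : ℕ) (τ c : ℝ) (v wm wp : ℕ → ℝ) (x : ℝ) : ℝ :=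
  sSup {r | ∃ s ∈ scenarios n wm wp, r = regret n τ c v s x}

/-- The left-pseudo-bipartite scenario `s(i, w)`. -/
def pseudoBipL (wm wp : ℕ → ℝ) (i : ℕ) (w : ℝ) : ℕ → ℝ :=
  fun l => if l < i then wp l else if l = i then w else wm l

/-- The right-pseudo-bipartite scenario `s(i, w)`. -/
def pseudoBipR (wm wp : ℕ → ℝ) (i : ℕ) (w : ℝ) : ℕ → ℝ :=
  fun l => if l < i then wm l else if l = i then w else wp l

/-- The head `ρ_m` of the left cluster containing vertex `i`: the smallest cluster head `≥ i`. -/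
noncomputable def clusterHeadOf (τ c : ℝ) (v w : ℕ → ℝ) (h i : ℕ) : ℕ :=
  ((((Finset.range (h + 1)).image (heads τ c v w h)).filter (fun r => i ≤ r)).min).getD h

/-- The head `ρ_{m−1}` preceding the left cluster containing vertex `i`:
the largest cluster head `< i`. -/
noncomputable def prevClusterHeadOf (τ c : ℝ) (v w : ℕ → ℝ) (h i : ℕ) : ℕ :=
  ((((Finset.range (h + 1)).image (heads τ c v w h)).filter (fun r => r < i)).max).getD 0

/-- The weight `σ_m` of the left cluster containing vertex `i`. -/
noncomputable def clusterWeightOf (τ c : ℝ) (v w : ℕ → ℝ) (h i : ℕ) : ℝ :=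
  ∑ l ∈ Finset.Ioc (prevClusterHeadOf τ c v w h i) (clusterHeadOf τ c v w h i), w l

/-- The sequence of right cluster heads for the vertex `y = v_j`
(expressed in the coordinates of the reflected network). -/
noncomputable def rightHeads (n : ℕ) (τ c : ℝ) (v w : ℕ → ℝ) (j : ℕ) : ℕ → ℕ :=
  heads τ c (rv n v) (rw n w) (hIdx n (rv n v) (-(v j)))

/-- The sequence of left cluster heads for the vertex `y = v_j`. -/
noncomputable def leftHeads (n : ℕ) (τ c : ℝ) (v w : ℕ → ℝ) (j : ℕ) : ℕ → ℕ :=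
  heads τ c v w (hIdx n v (v j))

/-- The (original-coordinates) index of the head of the right cluster for `y = v_j`
containing vertex `i`. -/
noncomputable def rightClusterHeadOf (n : ℕ) (τ c : ℝ) (v w : ℕ → ℝ) (j i : ℕ) : ℕ :=
  n + 1 - clusterHeadOf τ c (rv n v) (rw n w) (hIdx n (rv n v) (-(v j))) (n + 1 - i)

/-- The weight of the right cluster for `y = v_j` containing vertex `i`. -/
noncomputable def rightClusterWeightOf (n : ℕ) (τ c : ℝ) (v w : ℕ → ℝ) (j i : ℕ) : ℝ :=
  clusterWeightOf τ c (rv n v) (rw n w) (hIdx n (rv n v) (-(v j))) (n + 1 - i)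

/-- `ω` is a critical weight for `v_i` with respect to the vertex `y = v_j`
(left-pseudo-bipartite case): `ω ∈ {w_i^−, w_i^+}` or the right-cluster partition for `y`
under `s(i, ·)` is not constant on any neighborhood of `ω` in `[w_i^−, w_i^+]`. -/
def criticalWeightL (n : ℕ) (τ c : ℝ) (v wm wp : ℕ → ℝ) (j i : ℕ) (ω : ℝ) : Prop :=
  ω ∈ Set.Icc (wm i) (wp i) ∧
    (ω = wm i ∨ ω = wp i ∨
      ¬ ∃ ε > (0 : ℝ), ∀ w ∈ Set.Icc (wm i) (wp i), |w - ω| < ε →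
        rightHeads n τ c v (pseudoBipL wm wp i w) j =
          rightHeads n τ c v (pseudoBipL wm wp i ω) j)

/-- `ω` is a critical weight for `v_i` with respect to the vertex `y = v_j`
(right-pseudo-bipartite case, using the left-cluster partition for `y`). -/
def criticalWeightR (n : ℕ) (τ c : ℝ) (v wm wp : ℕ → ℝ) (j i : ℕ) (ω : ℝ) : Prop :=
  ω ∈ Set.Icc (wm i) (wp i) ∧
    (ω = wm i ∨ ω = wp i ∨
      ¬ ∃ ε > (0 : ℝ), ∀ w ∈ Set.Icc (wm i) (wp i), |w - ω| < ε →
        leftHeads n τ c v (pseudoBipR wm wp i w) j =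
          leftHeads n τ c v (pseudoBipR wm wp i ω) j)

/-- `Q`: the number of right clusters for `y = v_j` under weights `w` that lie entirely
to the right of the right cluster containing `v_i` (counted via reflected cluster heads). -/
noncomputable def Qnum (n : ℕ) (τ c : ℝ) (v w : ℕ → ℝ) (j i : ℕ) : ℕ :=
  (((Finset.range (n + 1)).image (rightHeads n τ c v w j)).filter
      (fun r => 1 ≤ r ∧
        r < clusterHeadOf τ c (rv n v) (rw n w) (hIdx n (rv n v) (-(v j))) (n + 1 - i))).card

end DPN

open DPN

namespace DPN

/-- The score from `r`, up to a quantity that does not depend on `j`. -/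
noncomputable def potential (τ c : ℝ) (v w : ℕ → ℝ) (j : ℕ) : ℝ :=
  (∑ l ∈ Finset.Ioc 0 j, w l) / c - τ * v j

lemma score_eq_potential (τ c : ℝ) (v w : ℕ → ℝ) (h : ℕ) {r j : ℕ} (hrj : r ≤ j) :
    score τ c v w h r j =
      potential τ c v w j + (τ * v h - (∑ l ∈ Finset.Ioc 0 r, w l) / c) := by
  have hsum := Finset.sum_Ioc_consecutive w (Nat.zero_le r) hrj
  rw [score, potential, ← hsum, add_div]
  ring

lemma nextHead_of_le (τ c : ℝ) (v w : ℕ → ℝ) {h r : ℕ} (hr : h ≤ r) :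
    nextHead τ c v w h r = h := by
  rw [nextHead, Finset.Ioc_eq_empty (by omega)]
  rfl

lemma nextHead_spec (τ c : ℝ) (v w : ℕ → ℝ) {h r : ℕ} (hr : r < h) :
    r < nextHead τ c v w h r ∧ nextHead τ c v w h r ≤ h ∧
      (∀ j, r < j → j ≤ h →
        potential τ c v w j ≤ potential τ c v w (nextHead τ c v w h r)) ∧
      ∀ j, nextHead τ c v w h r < j → j ≤ h →
        potential τ c v w j < potential τ c v w (nextHead τ c v w h r) := by
  set S := (Finset.Ioc r h).filter (fun j =>
      ∀ j' ∈ Finset.Ioc r h, score τ c v w h r j' ≤ score τ c v w h r j) with hS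
  have hmemS : ∀ j, j ∈ S ↔ (r < j ∧ j ≤ h) ∧
      ∀ j', r < j' → j' ≤ h → potential τ c v w j' ≤ potential τ c v w j := by
    intro j
    rw [hS, Finset.mem_filter, Finset.mem_Ioc]
    refine and_congr_right fun hj => forall_congr' fun j' => ?_
    rw [Finset.mem_Ioc, and_imp]
    refine forall_congr' fun hj' => forall_congr' fun _ => ?_
    rw [score_eq_potential τ c v w h hj'.le, score_eq_potential τ c v w h hj.1.le,
      add_le_add_iff_right]
  have hne : S.Nonempty := by
    obtain ⟨j, hj, hmax⟩ := Finset.exists_max_image (Finset.Ioc r h) (potential τ c v w)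
      ⟨h, Finset.mem_Ioc.2 ⟨hr, le_rfl⟩⟩
    exact ⟨j, (hmemS j).2 ⟨Finset.mem_Ioc.1 hj,
      fun j' h1 h2 => hmax j' (Finset.mem_Ioc.2 ⟨h1, h2⟩)⟩⟩
  obtain ⟨m, hm⟩ := Finset.max_of_nonempty hne
  have hnext : nextHead τ c v w h r = m := by
    rw [nextHead, ← hS, hm]
    rfl
  rw [hnext]
  obtain ⟨⟨h1, h2⟩, h3⟩ := (hmemS m).1 (Finset.mem_of_max hm)
  refine ⟨h1, h2, h3, fun j hj hjh => lt_of_le_of_ne (h3 j (h1.trans hj) hjh) fun heq => ?_⟩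
  have hjS : j ∈ S := (hmemS j).2 ⟨⟨h1.trans hj, hjh⟩, fun j' a b => heq ▸ h3 j' a b⟩
  exact absurd (Finset.le_max_of_eq hjS hm) (by omega)

lemma heads_le (τ c : ℝ) (v w : ℕ → ℝ) (h m : ℕ) : heads τ c v w h m ≤ h := by
  cases m with
  | zero => exact Nat.zero_le h
  | succ m =>
    rw [heads]
    rcases lt_or_ge (heads τ c v w h m) h with hlt | hge
    · exact (nextHead_spec τ c v w hlt).2.1
    · exact (nextHead_of_le τ c v w hge).le

/-- The cluster heads are `0` and the strict suffix maxima of the potential. -/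
lemma mem_image_heads_iff (τ c : ℝ) (v w : ℕ → ℝ) (h r : ℕ) :
    r ∈ (Finset.range (h + 1)).image (heads τ c v w h) ↔
      r = 0 ∨ (r ≤ h ∧ ∀ j, r < j → j ≤ h → potential τ c v w j < potential τ c v w r) := by
  rw [Finset.mem_image]
  constructor
  · rintro ⟨m, -, rfl⟩
    cases m with
    | zero => exact Or.inl rfl
    | succ m =>
      refine Or.inr ⟨heads_le τ c v w h _, ?_⟩
      rw [heads]
      rcases lt_or_ge (heads τ c v w h m) h with hlt | hge
      · exact (nextHead_spec τ c v w hlt).2.2.2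
      · rw [nextHead_of_le τ c v w hge]
        intro j h1 h2
        omega
  · rintro (rfl | ⟨hrh, hr⟩)
    · exact ⟨0, by simp, rfl⟩
    have key : ∀ m, (∃ k ≤ m, heads τ c v w h k = r) ∨
        (heads τ c v w h m < r ∧ m ≤ heads τ c v w h m) := by
      intro m
      induction m with
      | zero =>
        rcases Nat.eq_zero_or_pos r with h0 | hpos
        · exact Or.inl ⟨0, le_rfl, h0.symm⟩
        · exact Or.inr ⟨hpos, Nat.zero_le _⟩
      | succ m ih =>
        rcases ih with ⟨k, hk, hkr⟩ | ⟨hlt, hle⟩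
        · exact Or.inl ⟨k, by omega, hkr⟩
        obtain ⟨h1, h2, h3, -⟩ := nextHead_spec τ c v w (hlt.trans_le hrh)
        rcases lt_trichotomy (heads τ c v w h (m + 1)) r with hc' | hc' | hc'
        · exact Or.inr ⟨hc', lt_of_le_of_lt hle h1⟩
        · exact Or.inl ⟨m + 1, le_rfl, hc'⟩
        · exact absurd (h3 r hlt hrh) (not_le.2 (hr _ hc' h2))
    rcases key h with ⟨k, hk, hkr⟩ | ⟨h1, h2⟩
    · exact ⟨k, Finset.mem_range.2 (by omega), hkr⟩
    · omega

lemma le_clusterHeadOf (τ c : ℝ) (v w : ℕ → ℝ) {h i : ℕ} (hih : i ≤ h) :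
    i ≤ clusterHeadOf τ c v w h i := by
  rw [clusterHeadOf]
  set S := ((Finset.range (h + 1)).image (heads τ c v w h)).filter (fun r => i ≤ r) with hS
  rcases S.eq_empty_or_nonempty with he | hne
  · rw [he]
    exact hih
  · obtain ⟨m, hm⟩ := Finset.min_of_nonempty hne
    rw [hm]
    exact (Finset.mem_filter.1 (Finset.mem_of_min hm)).2

lemma isGreatest_prevClusterHeadOf (τ c : ℝ) (v w : ℕ → ℝ) (h : ℕ) {i : ℕ} (hi : 0 < i) :
    IsGreatest {r | r ∈ (Finset.range (h + 1)).image (heads τ c v w h) ∧ r < i}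
      (prevClusterHeadOf τ c v w h i) := by
  have hne : (((Finset.range (h + 1)).image (heads τ c v w h)).filter
      (fun r => r < i)).Nonempty :=
    ⟨0, Finset.mem_filter.2 ⟨(mem_image_heads_iff τ c v w h 0).2 (Or.inl rfl), hi⟩⟩
  obtain ⟨m, hm⟩ := Finset.max_of_nonempty hne
  have hprev : prevClusterHeadOf τ c v w h i = m := by
    rw [prevClusterHeadOf, hm]
    rfl
  rw [hprev]
  exact ⟨Finset.mem_filter.1 (Finset.mem_of_max hm),
    fun r hr => Finset.le_max_of_eq (Finset.mem_filter.2 ⟨hr.1, hr.2⟩) hm⟩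

lemma sum_pseudoBipL (wm wp : ℕ → ℝ) (i : ℕ) (a b : ℝ) (s : Finset ℕ) :
    ∑ l ∈ s, pseudoBipL wm wp i b l =
      ∑ l ∈ s, pseudoBipL wm wp i a l + if i ∈ s then b - a else 0 := by
  rw [← Finset.sum_ite_eq' s i (fun _ => b - a), ← Finset.sum_add_distrib]
  refine Finset.sum_congr rfl fun l _ => ?_
  unfold pseudoBipL
  split_ifs <;> first | omega | ring

lemma potential_pseudoBipL_of_lt (τ c : ℝ) (v wm wp : ℕ → ℝ) (a b : ℝ) {i j : ℕ} (hj : j < i) :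
    potential τ c v (pseudoBipL wm wp i b) j = potential τ c v (pseudoBipL wm wp i a) j := by
  rw [potential, potential, sum_pseudoBipL wm wp i a b,
    if_neg (fun hm => absurd (Finset.mem_Ioc.1 hm).2 (by omega)), add_zero]

lemma potential_pseudoBipL_of_le (τ c : ℝ) (v wm wp : ℕ → ℝ) (a b : ℝ) {i j : ℕ}
    (hi : 0 < i) (hj : i ≤ j) :
    potential τ c v (pseudoBipL wm wp i b) j =
      potential τ c v (pseudoBipL wm wp i a) j + (b - a) / c := by
  rw [potential, potential, sum_pseudoBipL wm wp i a b, if_pos (Finset.mem_Ioc.2 ⟨hi, hj⟩)]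
  ring

lemma clusterHeadOf_pseudoBipL (τ c : ℝ) (v wm wp : ℕ → ℝ) (a b : ℝ) (h : ℕ) {i : ℕ}
    (hi : 0 < i) :
    clusterHeadOf τ c v (pseudoBipL wm wp i b) h i =
      clusterHeadOf τ c v (pseudoBipL wm wp i a) h i := by
  rw [clusterHeadOf, clusterHeadOf]
  congr 2
  ext r
  rw [Finset.mem_filter, Finset.mem_filter, mem_image_heads_iff, mem_image_heads_iff]
  refine and_congr_left fun hir => or_congr_right (and_congr_right fun _ =>
    forall_congr' fun j => forall_congr' fun hj => forall_congr' fun _ => ?_)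
  rw [potential_pseudoBipL_of_le τ c v wm wp a b hi hir,
    potential_pseudoBipL_of_le τ c v wm wp a b hi (hir.trans hj.le), add_lt_add_iff_right]

/-- Raising the weight of the intermediate vertex can only move the preceding head left. -/
lemma prevClusterHeadOf_pseudoBipL_anti (τ : ℝ) {c : ℝ} (hc : 0 < c) (v wm wp : ℕ → ℝ)
    {a b : ℝ} (hab : a ≤ b) (h : ℕ) {i : ℕ} (hi : 0 < i) :
    prevClusterHeadOf τ c v (pseudoBipL wm wp i b) h i ≤
      prevClusterHeadOf τ c v (pseudoBipL wm wp i a) h i := by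
  refine (isGreatest_prevClusterHeadOf τ c v _ h hi).mono
    (isGreatest_prevClusterHeadOf τ c v _ h hi) ?_
  rintro r ⟨hr, hri⟩
  refine ⟨?_, hri⟩
  rw [mem_image_heads_iff] at hr ⊢
  refine hr.imp_right fun ⟨hrh, hr⟩ => ⟨hrh, fun j hrj hjh => ?_⟩
  have hlt := hr j hrj hjh
  rw [potential_pseudoBipL_of_lt τ c v wm wp a b hri] at hlt
  rcases lt_or_ge j i with hji | hij
  · rwa [potential_pseudoBipL_of_lt τ c v wm wp a b hji] at hlt
  · rw [potential_pseudoBipL_of_le τ c v wm wp a b hi hij] at hlt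
    have hnonneg : 0 ≤ (b - a) / c := div_nonneg (sub_nonneg.2 hab) hc.le
    linarith

lemma le_hIdx {n : ℕ} {v : ℕ → ℝ} (hv : ∀ i, 1 ≤ i → i < n → v i < v (i + 1)) {x : ℝ} {i : ℕ}
    (hi1 : 1 ≤ i) (hin : i ≤ n) (hix : v i < x) : i ≤ hIdx n v x := by
  have hmono : MonotoneOn v (Set.Icc 1 n) :=
    monotoneOn_of_le_add_one Set.ordConnected_Icc fun j _ hj hj' =>
      (hv j hj.1 (Nat.lt_of_succ_le hj'.2)).le
  have hsub : Finset.Icc 1 i ⊆ (Finset.Icc 1 n).filter (fun i => v i < x) := by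
    intro j hj
    obtain ⟨h1, h2⟩ := Finset.mem_Icc.1 hj
    exact Finset.mem_filter.2 ⟨Finset.mem_Icc.2 ⟨h1, h2.trans hin⟩,
      (hmono ⟨h1, h2.trans hin⟩ ⟨hi1, hin⟩ h2).trans_lt hix⟩
  simpa [hIdx] using Finset.card_le_card hsub

end DPN

theorem stmt13 (n : ℕ) (τ c : ℝ) (hτ : 0 < τ) (hc : 0 < c) (v : ℕ → ℝ)
    (hv : ∀ i, 1 ≤ i → i < n → v i < v (i + 1))
    (wm wp : ℕ → ℝ) (hwm : ∀ i, 1 ≤ i → i ≤ n → 0 < wm i)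
    (hwmp : ∀ i, 1 ≤ i → i ≤ n → wm i ≤ wp i)
    (x : ℝ) (hx : x ∈ Set.Icc (v 1) (v n))
    (i : ℕ) (hi1 : 1 ≤ i) (hin : i ≤ n) (hix : v i < x) :
    MonotoneOn
      (fun w => clusterWeightOf τ c v (pseudoBipL wm wp i w) (hIdx n v x) i - w)
      (Set.Icc (wm i) (wp i)) := by
  intro a _ b _ hab
  have hi : 0 < i := hi1
  have hprev := prevClusterHeadOf_pseudoBipL_anti τ hc v wm wp hab (hIdx n v x) hi
  have hprev_lt : prevClusterHeadOf τ c v (pseudoBipL wm wp i a) (hIdx n v x) i < i :=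
    (isGreatest_prevClusterHeadOf τ c v _ (hIdx n v x) hi).1.2
  have hhead := le_clusterHeadOf τ c v (pseudoBipL wm wp i a) (le_hIdx hv hi1 hin hix)
  simp only [clusterWeightOf, clusterHeadOf_pseudoBipL τ c v wm wp a b (hIdx n v x) hi]
  rw [sum_pseudoBipL wm wp i a b,
    if_pos (Finset.mem_Ioc.2 ⟨hprev.trans_lt hprev_lt, hhead⟩)]
  have hle := Finset.sum_le_sum_of_subset_of_nonneg (f := pseudoBipL wm wp i a)
    (Finset.Ioc_subset_Ioc_left
      (b := clusterHeadOf τ c v (pseudoBipL wm wp i a) (hIdx n v x) i) hprev) fun l hl hl' => by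
      rw [Finset.mem_Ioc] at hl hl'
      have hli : l < i := by omega
      rw [pseudoBipL, if_pos hli]
      exact (hwm l (by omega) (by omega)).le.trans (hwmp l (by omega) (by omega))
  linarith
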